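/- The set of characters of L^∞([0,1], λ) (unital ℂ-algebra homomorphisms L^∞([0,1], λ) → ℂ) has cardinality 2^(2^ℵ₀). -/

import Mathlib

open MeasureTheory

open Filter in
/-- `ℂ`-algebra structure on the algebra of germs of `ℂ`-valued functions along a filter. -/
noncomputable instance germAlgebra {α : Type*} {l : Filter α} :
    Algebra ℂ (Filter.Germ l ℂ) :=
  Algebra.ofModule
    (fun r x y => Filter.Germ.inductionOn₂ x y fun f g => by
      simp only [← Filter.Germ.coe_smul, ← Filter.Germ.coe_mul, smul_mul_assoc])
    (fun r x y => Filter.Germ.inductionOn₂ x y fun f g => by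
      simp only [← Filter.Germ.coe_smul, ← Filter.Germ.coe_mul, mul_smul_comm])

/-- `L^∞(Ω, μ)`: the algebra of essentially bounded measurable functions `Ω → ℂ` modulo
equality `μ`-almost everywhere, realized as the subalgebra of the algebra of germs along
the `μ`-a.e. filter consisting of germs of essentially bounded measurable functions. -/
noncomputable def Linfty {Ω : Type*} [MeasurableSpace Ω] (μ : Measure Ω) :
    Subalgebra ℂ (Filter.Germ (MeasureTheory.ae μ) ℂ) where
  carrier := {x | ∃ f : Ω → ℂ, Measurable f ∧ (∃ C : ℝ, ∀ᵐ ω ∂μ, ‖f ω‖ ≤ C) ∧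
    x = (f : Filter.Germ (MeasureTheory.ae μ) ℂ)}
  mul_mem' := by
    rintro x y ⟨f, hf, ⟨Cf, hCf⟩, rfl⟩ ⟨g, hg, ⟨Cg, hCg⟩, rfl⟩
    refine ⟨f * g, hf.mul hg, ⟨|Cf| * |Cg|, ?_⟩, (Filter.Germ.coe_mul f g).symm⟩
    filter_upwards [hCf, hCg] with ω h1 h2
    calc ‖(f * g) ω‖ = ‖f ω‖ * ‖g ω‖ := by simp [norm_mul]
      _ ≤ |Cf| * |Cg| :=
        mul_le_mul (h1.trans (le_abs_self _)) (h2.trans (le_abs_self _)) (norm_nonneg _)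
          (abs_nonneg _)
  add_mem' := by
    rintro x y ⟨f, hf, ⟨Cf, hCf⟩, rfl⟩ ⟨g, hg, ⟨Cg, hCg⟩, rfl⟩
    refine ⟨f + g, hf.add hg, ⟨|Cf| + |Cg|, ?_⟩, (Filter.Germ.coe_add f g).symm⟩
    filter_upwards [hCf, hCg] with ω h1 h2
    calc ‖(f + g) ω‖ ≤ ‖f ω‖ + ‖g ω‖ := norm_add_le _ _
      _ ≤ |Cf| + |Cg| := add_le_add (h1.trans (le_abs_self _)) (h2.trans (le_abs_self _))
  one_mem' :=
    ⟨fun _ => 1, measurable_const, ⟨1, Filter.Eventually.of_forall fun _ => by simp⟩,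
      (Filter.Germ.coe_one (l := MeasureTheory.ae μ)).symm⟩
  zero_mem' :=
    ⟨fun _ => 0, measurable_const, ⟨0, Filter.Eventually.of_forall fun _ => by simp⟩,
      (Filter.Germ.coe_zero (l := MeasureTheory.ae μ)).symm⟩
  algebraMap_mem' := by
    intro r
    refine ⟨fun _ => r, measurable_const,
      ⟨‖r‖, Filter.Eventually.of_forall fun _ => le_rfl⟩, ?_⟩
    rw [Algebra.algebraMap_eq_smul_one, ← Filter.Germ.coe_one (l := MeasureTheory.ae μ),
      ← Filter.Germ.coe_smul]
    congr 1
    funext ω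
    simp

/-- The element of `L^∞(Ω, μ)` determined by a measurable, essentially bounded function. -/
noncomputable def LinftyMk {Ω : Type*} [MeasurableSpace Ω] (μ : Measure Ω) (f : Ω → ℂ)
    (hf : Measurable f) (C : ℝ) (hC : ∀ᵐ ω ∂μ, ‖f ω‖ ≤ C) : Linfty μ :=
  ⟨(f : Filter.Germ (MeasureTheory.ae μ) ℂ), ⟨f, hf, ⟨C, hC⟩, rfl⟩⟩

/-- The class `[1_F]` in `L^∞(Ω, μ)` of the indicator function of a measurable set `F`. -/
noncomputable def indL {Ω : Type*} [MeasurableSpace Ω] (μ : Measure Ω) (F : Set Ω)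
    (hF : MeasurableSet F) : Linfty μ :=
  LinftyMk μ (F.indicator fun _ => (1 : ℂ)) (measurable_const.indicator hF) 1
    (Filter.Eventually.of_forall fun ω => by
      by_cases h : ω ∈ F <;> simp [Set.indicator_apply, h])

/-- Lebesgue measure on the unit interval `[0,1]`, regarded as a measure on the subtype. -/
noncomputable def lam : Measure (Set.Icc (0 : ℝ) 1) :=
  (MeasureTheory.volume : Measure ℝ).comap Subtype.val

open Filter Topology in
/-- Along an ultrafilter, an eventually bounded complex function converges. -/
theorem tendsto_limUnder_of_eventually_norm_le {α : Type*} (U : Ultrafilter α) {f : α → ℂ} {C : ℝ}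
    (hC : ∀ᶠ a in (U : Filter α), ‖f a‖ ≤ C) :
    Tendsto f U (𝓝 (limUnder (U : Filter α) f)) := by
  have hmem : ((U.map f : Ultrafilter ℂ) : Filter ℂ) ≤ 𝓟 (Metric.closedBall 0 C) := by
    rw [le_principal_iff]
    change ∀ᶠ a in (U : Filter α), f a ∈ Metric.closedBall 0 C
    filter_upwards [hC] with a ha
    simpa using ha
  obtain ⟨c, -, hc⟩ := (isCompact_closedBall (0 : ℂ) C).ultrafilter_le_nhds _ hmem
  exact tendsto_nhds_limUnder ⟨c, hc⟩

open Filter Topology in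
/-- The character of `L^∞(Ω, μ)` given by the limit along an ultrafilter finer than the
`μ`-a.e. filter. -/
noncomputable def ultrafilterCharacter {Ω : Type*} [MeasurableSpace Ω] (μ : Measure Ω)
    (U : Ultrafilter Ω) (hU : (U : Filter Ω) ≤ ae μ) : Linfty μ →ₐ[ℂ] ℂ :=
  AlgHom.ofLinearMap
    { toFun := fun x => Filter.Germ.liftOn x.1 (fun f => limUnder (U : Filter Ω) f)
        fun f g hfg => by
          change lim (map f U) = lim (map g U)
          rw [map_congr (hU hfg)]
      map_add' := by
        rintro ⟨_, f, -, ⟨C, hC⟩, rfl⟩ ⟨_, g, -, ⟨D, hD⟩, rfl⟩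
        exact ((tendsto_limUnder_of_eventually_norm_le U (hU hC)).add
          (tendsto_limUnder_of_eventually_norm_le U (hU hD))).limUnder_eq
      map_smul' := by
        rintro r ⟨_, f, -, ⟨C, hC⟩, rfl⟩
        exact ((tendsto_limUnder_of_eventually_norm_le U (hU hC)).const_smul r).limUnder_eq }
    (tendsto_const_nhds (x := (1 : ℂ)) (f := (U : Filter Ω))).limUnder_eq
    (by
      rintro ⟨_, f, -, ⟨C, hC⟩, rfl⟩ ⟨_, g, -, ⟨D, hD⟩, rfl⟩
      exact ((tendsto_limUnder_of_eventually_norm_le U (hU hC)).mul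
        (tendsto_limUnder_of_eventually_norm_le U (hU hD))).limUnder_eq)

open Filter Topology in
theorem ultrafilterCharacter_indL_eq_one_iff {Ω : Type*} [MeasurableSpace Ω] (μ : Measure Ω)
    (U : Ultrafilter Ω) (hU : (U : Filter Ω) ≤ ae μ) (F : Set Ω) (hF : MeasurableSet F) :
    ultrafilterCharacter μ U hU (indL μ F hF) = 1 ↔ F ∈ U := by
  have key : ∀ c : ℂ, (∀ᶠ ω in (U : Filter Ω), F.indicator (fun _ => (1 : ℂ)) ω = c) →
      ultrafilterCharacter μ U hU (indL μ F hF) = c := fun c hc =>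
    ((tendsto_congr' hc).2 tendsto_const_nhds).limUnder_eq
  constructor
  · intro h
    by_contra hFU
    have h0 := key 0 <| by
      filter_upwards [Ultrafilter.compl_mem_iff_notMem.2 hFU] with ω hω
      exact Set.indicator_of_notMem hω _
    exact zero_ne_one (h0.symm.trans h)
  · intro h
    refine key 1 ?_
    filter_upwards [h] with ω hω
    exact Set.indicator_of_mem hω _

open Classical in
/-- The member indexed by `Y` of the Fichtenholz–Kantorovich independent family of subsets of
a countable set. -/
def independentSet (Y : Set ℕ) : Set (Finset ℕ × Finset (Finset ℕ)) :=
  {p | p.1.filter (· ∈ Y) ∈ p.2}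

open Classical in
/-- Every finite Boolean combination of distinct members of the family `independentSet` is
nonempty. -/
theorem exists_mem_independentSet_iff (s : Set (Set ℕ)) (T : Finset (Set ℕ)) :
    ∃ p, ∀ Y ∈ T, p ∈ independentSet Y ↔ Y ∈ s := by
  have hsep : ∀ Y Z : Set ℕ, ∃ n, Y ≠ Z → ¬(n ∈ Y ↔ n ∈ Z) := by
    intro Y Z
    by_contra! h
    exact (h 0).1 (Set.ext fun n => (h n).2)
  choose n hn using hsep
  let F : Finset ℕ := (T ×ˢ T).image fun q => n q.1 q.2
  have hF : ∀ Y ∈ T, ∀ Z ∈ T, F.filter (· ∈ Y) = F.filter (· ∈ Z) → Y = Z := by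
    intro Y hY Z hZ h
    by_contra hYZ
    have hmem : n Y Z ∈ F :=
      Finset.mem_image.2 ⟨(Y, Z), Finset.mem_product.2 ⟨hY, hZ⟩, rfl⟩
    have := Finset.ext_iff.1 h (n Y Z)
    simp only [Finset.mem_filter, hmem, true_and] at this
    exact hn Y Z hYZ this
  refine ⟨(F, (T.filter (· ∈ s)).image fun Y => F.filter (· ∈ Y)), fun Y hY => ?_⟩
  simp only [independentSet, Set.mem_ofPred_eq, Finset.mem_image, Finset.mem_filter]
  constructor
  · rintro ⟨Z, ⟨hZ, hZs⟩, h⟩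
    exact hF Z hZ Y hY h ▸ hZs
  · exact fun h => ⟨Y, ⟨hY, h⟩, rfl⟩

open Classical in
/-- Every subset of the index set of `independentSet` is cut out by an ultrafilter. -/
theorem exists_ultrafilter_independentSet_mem_iff (s : Set (Set ℕ)) :
    ∃ V : Ultrafilter (Finset ℕ × Finset (Finset ℕ)), ∀ Y, independentSet Y ∈ V ↔ Y ∈ s := by
  let B : Set ℕ → Set (Finset ℕ × Finset (Finset ℕ)) := fun Y =>
    {p | p ∈ independentSet Y ↔ Y ∈ s}
  have hne : (Filter.generate (Set.range B)).NeBot := by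
    rw [Filter.generate_neBot_iff]
    intro t ht hfin
    lift t to Finset (Set (Finset ℕ × Finset (Finset ℕ))) using hfin
    rw [← Set.image_univ, Finset.subset_set_image_iff] at ht
    obtain ⟨T, -, rfl⟩ := ht
    obtain ⟨p, hp⟩ := exists_mem_independentSet_iff s T
    refine ⟨p, ?_⟩
    simpa [B] using hp
  refine ⟨Ultrafilter.of (Filter.generate (Set.range B)), fun Y => ?_⟩
  have hB : B Y ∈ Ultrafilter.of (Filter.generate (Set.range B)) :=
    Ultrafilter.of_le _ (Filter.mem_generate_of_mem ⟨Y, rfl⟩)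
  by_cases hY : Y ∈ s
  · simpa [B, hY] using hB
  · rw [← Ultrafilter.compl_mem_iff_notMem.not_left]
    simpa [B, hY, Set.compl_def] using hB

open Filter in
/-- If all fibres of `g` are non-null, then every ultrafilter is the image under `g` of an
ultrafilter finer than the a.e. filter. -/
theorem exists_ultrafilter_le_ae_map_eq {Ω S : Type*} [MeasurableSpace Ω] {μ : Measure Ω}
    {g : Ω → S} (hg : ∀ p, μ (g ⁻¹' {p}) ≠ 0) (V : Ultrafilter S) :
    ∃ U : Ultrafilter Ω, (U : Filter Ω) ≤ ae μ ∧ U.map g = V := by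
  have hV : (V : Filter S) ≤ map g (ae μ) := by
    intro t ht
    have : t = Set.univ := by
      refine Set.eq_univ_of_forall fun p => ?_
      by_contra hp
      refine hg p (measure_mono_null ?_ (mem_ae_iff.1 (mem_map.1 ht)))
      rintro ω rfl
      exact hp
    exact this ▸ univ_mem
  have hne : (ae μ ⊓ comap g V).NeBot := by
    rw [← map_neBot_iff g, Filter.push_pull, inf_eq_right.2 hV]
    infer_instance
  refine ⟨Ultrafilter.of (ae μ ⊓ comap g V), (Ultrafilter.of_le _).trans inf_le_left, ?_⟩
  refine Ultrafilter.coe_le_coe.1 ?_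
  exact map_le_iff_le_comap.2 ((Ultrafilter.of_le _).trans inf_le_right)

theorem two_power_two_power_aleph0_le_card_characters {Ω : Type*} [MeasurableSpace Ω]
    {μ : Measure Ω} {g : Ω → ℕ} (hg : Measurable g) (hg0 : ∀ n, μ (g ⁻¹' {n}) ≠ 0) :
    (2 : Cardinal) ^ ((2 : Cardinal) ^ Cardinal.aleph0) ≤ Cardinal.mk (Linfty μ →ₐ[ℂ] ℂ) := by
  let e : ℕ ≃ Finset ℕ × Finset (Finset ℕ) := (Denumerable.eqv _).symm
  have hU : ∀ s : Set (Set ℕ), ∃ U : Ultrafilter Ω, (U : Filter Ω) ≤ ae μ ∧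
      ∀ Y, (e ∘ g) ⁻¹' independentSet Y ∈ U ↔ Y ∈ s := by
    intro s
    obtain ⟨V, hV⟩ := exists_ultrafilter_independentSet_mem_iff s
    obtain ⟨U, hU, rfl⟩ := exists_ultrafilter_le_ae_map_eq (μ := μ) (g := e ∘ g)
      (fun p => by
        have : (e ∘ g) ⁻¹' {p} = g ⁻¹' {e.symm p} := by
          ext ω
          simp [Equiv.eq_symm_apply]
        exact this ▸ hg0 _) V
    exact ⟨U, hU, hV⟩
  choose U hUae hU using hU
  have hmeas : ∀ Y, MeasurableSet ((e ∘ g) ⁻¹' independentSet Y) := fun Y =>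
    hg (MeasurableSet.of_discrete (s := e ⁻¹' independentSet Y))
  have hinj : Function.Injective fun s => ultrafilterCharacter μ (U s) (hUae s) := by
    intro s t hst
    ext Y
    rw [← hU s, ← hU t, ← ultrafilterCharacter_indL_eq_one_iff μ _ (hUae s) _ (hmeas Y),
      ← ultrafilterCharacter_indL_eq_one_iff μ _ (hUae t) _ (hmeas Y)]
    exact iff_of_eq (congrArg (fun χ : Linfty μ →ₐ[ℂ] ℂ => χ (indL μ _ (hmeas Y)) = 1) hst)
  have h := Cardinal.lift_mk_le_lift_mk_of_injective hinj
  rw [Cardinal.mk_set, Cardinal.mk_set, Cardinal.mk_nat] at h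
  simpa only [Cardinal.lift_power, Cardinal.lift_ofNat, Cardinal.lift_aleph0, Cardinal.lift_id,
    Cardinal.lift_id', Cardinal.lift_uzero] using h

open Cardinal in
theorem mk_measurable_le_continuum (Ω E : Type*) [MeasurableSpace Ω]
    [MeasurableSpace.CountablyGenerated Ω] [MeasurableSpace E]
    [MeasurableSpace.CountablyGenerated E] [MeasurableSpace.SeparatesPoints E] :
    #{f : Ω → E // Measurable f} ≤ 𝔠 := by
  have hsets : #{t : Set Ω | MeasurableSet t} ≤ 𝔠 := by
    obtain ⟨b, hb, rfl⟩ := MeasurableSpace.CountablyGenerated.isCountablyGenerated (α := Ω)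
    exact MeasurableSpace.cardinal_measurableSet_le_continuum
      (hb.le_aleph0.trans aleph0_le_continuum)
  let φ : {f : Ω → E // Measurable f} → ℕ → {t : Set Ω | MeasurableSet t} := fun f n =>
    ⟨f.1 ⁻¹' MeasurableSpace.natGeneratingSequence E n,
      f.2 (MeasurableSpace.measurableSet_natGeneratingSequence n)⟩
  have hφ : Function.Injective φ := by
    intro f g hfg
    ext ω
    refine MeasurableSpace.injective_mapNatBool E (funext fun n => ?_)
    have := Set.ext_iff.1 (congrArg Subtype.val (congrFun hfg n)) ω
    change f.1 ω ∈ MeasurableSpace.natGeneratingSequence E n ↔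
      g.1 ω ∈ MeasurableSpace.natGeneratingSequence E n at this
    simpa [MeasurableSpace.mapNatBool] using this
  have h := lift_mk_le_lift_mk_of_injective hφ
  rw [← lift_le_continuum]
  refine h.trans ?_
  rw [lift_le_continuum, mk_arrow, mk_nat, lift_aleph0, lift_uzero, ← continuum_power_aleph0]
  exact power_le_power_right hsets

open Cardinal in
theorem mk_Linfty_le_continuum {Ω : Type*} [MeasurableSpace Ω]
    [MeasurableSpace.CountablyGenerated Ω] (μ : Measure Ω) : #(Linfty μ) ≤ 𝔠 := by
  let ψ : Linfty μ → {f : Ω → ℂ // Measurable f} := fun x =>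
    ⟨x.2.choose, x.2.choose_spec.1⟩
  have hψ : Function.Injective ψ := by
    intro x y hxy
    apply Subtype.ext
    rw [x.2.choose_spec.2.2, y.2.choose_spec.2.2]
    exact congrArg (fun f : {f : Ω → ℂ // Measurable f} => (f.1 : Filter.Germ (ae μ) ℂ)) hxy
  exact (mk_le_of_injective hψ).trans (mk_measurable_le_continuum Ω ℂ)

open Cardinal in
theorem card_characters_le {Ω : Type*} [MeasurableSpace Ω]
    [MeasurableSpace.CountablyGenerated Ω] (μ : Measure Ω) :
    #(Linfty μ →ₐ[ℂ] ℂ) ≤ 2 ^ (2 ^ ℵ₀ : Cardinal) := by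
  have h := mk_le_of_injective (DFunLike.coe_injective (F := Linfty μ →ₐ[ℂ] ℂ))
  rw [mk_arrow, Cardinal.mk_complex, lift_continuum, lift_uzero] at h
  rw [two_power_aleph0, ← power_self_eq aleph0_le_continuum]
  exact h.trans (power_le_power_left continuum_ne_zero (mk_Linfty_le_continuum μ))

theorem lam_apply (s : Set (Set.Icc (0 : ℝ) 1)) : lam s = volume (Subtype.val '' s) :=
  (MeasurableEmbedding.subtype_coe measurableSet_Icc).comap_apply _ _

theorem lam_preimage_floor_inv_ne_zero (n : ℕ) :
    lam ((fun x : Set.Icc (0 : ℝ) 1 => ⌊(x : ℝ)⁻¹⌋₊ - 1) ⁻¹' {n}) ≠ 0 := by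
  have hn : (0 : ℝ) < n + 1 := by positivity
  rw [lam_apply]
  have hsub : Set.Ioo ((n + 2 : ℝ)⁻¹) ((n + 1 : ℝ)⁻¹) ⊆
      Subtype.val '' ((fun x : Set.Icc (0 : ℝ) 1 => ⌊(x : ℝ)⁻¹⌋₊ - 1) ⁻¹' {n}) := by
    rintro x ⟨hx1, hx2⟩
    have hx0 : 0 < x := lt_trans (by positivity) hx1
    have hx1' : x ≤ 1 := hx2.le.trans (inv_le_one_of_one_le₀ (by linarith))
    refine ⟨⟨x, hx0.le, hx1'⟩, ?_, rfl⟩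
    have hfloor : ⌊x⁻¹⌋₊ = n + 1 := by
      rw [Nat.floor_eq_iff (by positivity)]
      push_cast
      exact ⟨((lt_inv_comm₀ hx0 hn).1 hx2).le,
        by linarith [(inv_lt_comm₀ (by linarith) hx0).1 hx1]⟩
    simp [hfloor]
  intro h
  have := measure_mono_null hsub h
  rw [Real.volume_Ioo, ENNReal.ofReal_eq_zero, sub_nonpos] at this
  exact absurd this (not_le.2 (inv_strictAnti₀ hn (by linarith)))

/-- Theorem III.14. The spectrum of `L^∞([0,1], λ)`, i.e. the set of
its characters, has cardinality `2 ^ (2 ^ ℵ₀)`. -/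
theorem card_characters_Linfty_unitInterval :
    Cardinal.mk (Linfty lam →ₐ[ℂ] ℂ) = (2 : Cardinal) ^ ((2 : Cardinal) ^ Cardinal.aleph0) := by
  exact le_antisymm (card_characters_le lam)
    (two_power_two_power_aleph0_le_card_characters
      ((Nat.measurable_floor.comp measurable_subtype_coe.inv).sub_const 1)
      lam_preimage_floor_inv_ne_zero)
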